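/- Let n ≥ 2, b > 0, and let f : ℝⁿ₊ → ℝ be bounded and measurable with support contained in B₁(0) ∩ ℝⁿ₊. Let u ∈ C²(ℝⁿ₊) satisfy −Δu − b·(∂_n u)/x_n = f in ℝⁿ₊. Assume that u, Du, D²u and (∂_n u)/x_n are bounded on ℝ^{n-1} × (0,1), and that there is a constant A with ‖D^k u(x)‖ ≤ A/|x|^{n−2+b+k} for k = 0,1,2 and all x ∈ ℝⁿ₊ with |x| > 2. Then ∫_{ℝⁿ₊} Σ_{i,j=1}^n (∂_{ij}u)² dμ_b + b ∫_{ℝⁿ₊} ((∂_n u)/x_n)² dμ_b = ∫_{ℝⁿ₊} f² dμ_b. -/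

import Mathlib

open MeasureTheory
open scoped ENNReal

noncomputable section

/-- Euclidean n-space. -/
abbrev Eu (n : ℕ) := EuclideanSpace ℝ (Fin n)

/-- Partial derivative ∂ψ/∂xᵢ. -/
def pd {n : ℕ} (ψ : Eu n → ℝ) (i : Fin n) (x : Eu n) : ℝ :=
  fderiv ℝ ψ x (EuclideanSpace.single i 1)

/-- Second partial derivative ∂²ψ/∂xᵢ∂xⱼ. -/
def pd2 {n : ℕ} (ψ : Eu n → ℝ) (i j : Fin n) (x : Eu n) : ℝ :=
  pd (pd ψ j) i x

open Filter Topology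

section IntegrationByParts

variable {n : ℕ} {Ω : Set (Eu n)}

lemma contDiffAt_pd {k : ℕ} {v : Eu n → ℝ} {x : Eu n} (h : ContDiffAt ℝ (k + 1 : ℕ) v x)
    (i : Fin n) : ContDiffAt ℝ k (pd v i) x := by
  have h1 : ContDiffAt ℝ k (fderiv ℝ v) x := h.fderiv_right (by norm_cast)
  exact h1.clm_apply contDiffAt_const

lemma pd_mul {v w : Eu n → ℝ} {x : Eu n} (hv : DifferentiableAt ℝ v x)
    (hw : DifferentiableAt ℝ w x) (i : Fin n) :
    pd (fun y => v y * w y) i x = v x * pd w i x + pd v i x * w x := by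
  simp only [pd]
  rw [fderiv_fun_mul hv hw]
  simp [mul_comm]

lemma pd_congr {v w : Eu n → ℝ} {x : Eu n} (h : v =ᶠ[𝓝 x] w) (i : Fin n) :
    pd v i x = pd w i x := by
  simp only [pd, h.fderiv_eq]

lemma pd_eq_zero_of_notMem {v : Eu n → ℝ} {x : Eu n} (h : x ∉ tsupport v) (i : Fin n) :
    pd v i x = 0 := by
  have h1 : v =ᶠ[𝓝 x] fun _ => 0 := notMem_tsupport_iff_eventuallyEq.1 h
  rw [pd_congr h1]
  simp [pd]

lemma contDiff_of_forall_mem_tsupport {k : ℕ} {v : Eu n → ℝ}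
    (h : ∀ x ∈ tsupport v, ContDiffAt ℝ k v x) : ContDiff ℝ k v := by
  rw [contDiff_iff_contDiffAt]
  intro x
  by_cases hx : x ∈ tsupport v
  · exact h x hx
  · exact contDiffAt_const.congr_of_eventuallyEq (notMem_tsupport_iff_eventuallyEq.1 hx)

lemma pd2_eq_fderiv_fderiv {v : Eu n → ℝ} {x : Eu n} (h : ContDiffAt ℝ 2 v x) (i j : Fin n) :
    pd2 v i j x = fderiv ℝ (fderiv ℝ v) x (EuclideanSpace.single i 1)
      (EuclideanSpace.single j 1) := by
  have h1 : ContDiffAt ℝ 1 (fderiv ℝ v) x := h.fderiv_right (by norm_num)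
  have h2 : DifferentiableAt ℝ (fderiv ℝ v) x := h1.differentiableAt (by norm_num)
  simp only [pd2]
  unfold pd
  rw [fderiv_clm_apply h2 (differentiableAt_const _)]
  simp

lemma pd2_comm {v : Eu n → ℝ} {x : Eu n} (h : ContDiffAt ℝ 2 v x) (i j : Fin n) :
    pd2 v i j x = pd2 v j i x := by
  rw [pd2_eq_fderiv_fderiv h, pd2_eq_fderiv_fderiv h]
  exact (h.isSymmSndFDerivAt (by simp)).eq _ _

lemma integrable_of_continuousAt {F : Eu n → ℝ} {K : Set (Eu n)} (hK : IsCompact K)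
    (hF : ∀ x ∈ K, ContinuousAt F x) (h0 : ∀ x ∉ K, F x = 0) : Integrable F := by
  have h1 : IntegrableOn F K :=
    ContinuousOn.integrableOn_compact hK fun x hx => (hF x hx).continuousWithinAt
  refine (integrableOn_iff_integrable_of_support_subset ?_).1 h1
  intro x hx
  by_contra h
  exact hx (h0 x h)

lemma integral_pd_eq_zero {g : Eu n → ℝ} (hg : ContDiff ℝ 1 g) (hgc : HasCompactSupport g)
    (i : Fin n) : ∫ x, pd g i x = 0 := by
  have hcont : Continuous fun x => fderiv ℝ g x (EuclideanSpace.single i 1) :=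
    (hg.continuous_fderiv (by norm_num)).clm_apply continuous_const
  have h := integral_mul_fderiv_eq_neg_fderiv_mul_of_integrable (μ := (volume : Measure (Eu n)))
    (f := fun _ => (1 : ℝ)) (g := g) (v := EuclideanSpace.single i 1)
    (by simp) (by simpa using hcont.integrable_of_hasCompactSupport (hgc.fderiv_apply ℝ _))
    (by simpa using hg.continuous.integrable_of_hasCompactSupport hgc)
    (fun x _ => differentiableAt_const _) (fun x _ => hg.differentiable (by norm_num) x)
  simpa [pd] using h

lemma integral_pd_mul_eq_neg {g h : Eu n → ℝ} (hg : ContDiff ℝ 1 g) (hgc : HasCompactSupport g)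
    (hh : ContDiff ℝ 1 h) (i : Fin n) :
    ∫ x, pd g i x * h x = - ∫ x, g x * pd h i x := by
  have hg' : Continuous fun x => pd g i x :=
    (hg.continuous_fderiv (by norm_num)).clm_apply continuous_const
  have hh' : Continuous fun x => pd h i x :=
    (hh.continuous_fderiv (by norm_num)).clm_apply continuous_const
  have hgc' : HasCompactSupport fun x => pd g i x := hgc.fderiv_apply ℝ _
  have h1 := integral_pd_eq_zero (hg.mul hh) (hgc.mul_right (f' := h)) i
  have h2 : ∀ x, pd (fun y => g y * h y) i x = g x * pd h i x + pd g i x * h x := fun x =>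
    pd_mul (hg.differentiable (by norm_num) x) (hh.differentiable (by norm_num) x) i
  simp only [h2] at h1
  rw [integral_add] at h1
  · linarith
  · exact (hg.continuous.mul hh').integrable_of_hasCompactSupport hgc.mul_right
  · exact (hg'.mul hh.continuous).integrable_of_hasCompactSupport hgc'.mul_right

lemma integral_pd_mul_pd_comm_of_compact {v g : Eu n → ℝ} (hv : ContDiff ℝ 1 v)
    (hvc : HasCompactSupport v) (hg : ContDiff ℝ 1 g) (hgc : HasCompactSupport g) (i j : Fin n) :
    ∫ x, pd v j x * pd g i x = ∫ x, pd v i x * pd g j x := by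
  obtain ⟨Cv, hCv⟩ := hv.lipschitzWith_of_hasCompactSupport hvc (by norm_num)
  obtain ⟨Cg, hCg⟩ := hg.lipschitzWith_of_hasCompactSupport hgc (by norm_num)
  have cont : ∀ {h : Eu n → ℝ} (k : Fin n), ContDiff ℝ 1 h → Continuous fun x => pd h k x :=
    fun k hh => (hh.continuous_fderiv (by norm_num)).clm_apply continuous_const
  have T1 := hCg.integral_inv_smul_sub_mul_tendsto_integral_lineDeriv_mul
    (μ := (volume : Measure (Eu n)))
    ((cont j hv).integrable_of_hasCompactSupport (hvc.fderiv_apply ℝ _))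
    (EuclideanSpace.single i 1)
  have T2 := hCv.integral_inv_smul_sub_mul_tendsto_integral_lineDeriv_mul
    (μ := (volume : Measure (Eu n)))
    ((cont j hg).integrable_of_hasCompactSupport (hgc.fderiv_apply ℝ _))
    (-EuclideanSpace.single i 1)
  have key : ∀ t : ℝ, ∫ x, t⁻¹ • (g (x + t • EuclideanSpace.single i 1) - g x) * pd v j x
      = - ∫ x, t⁻¹ • (v (x + t • (-EuclideanSpace.single i 1)) - v x) * pd g j x := by
    intro t
    set e : Eu n := t • EuclideanSpace.single i 1 with he
    have hgt : ContDiff ℝ 1 fun x => g (x + e) := hg.comp (contDiff_id.add contDiff_const)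
    have hpt : ∀ x, pd (fun x => g (x + e)) j x = pd g j (x + e) := fun x => by
      simp only [pd, fderiv_comp_add_right]
    have A1 : ∫ x, pd v j x * g (x + e) = - ∫ x, v x * pd g j (x + e) := by
      rw [integral_pd_mul_eq_neg hv hvc hgt]
      simp only [hpt]
    have A2 : ∫ x, v x * pd g j (x + e) = ∫ x, v (x - e) * pd g j x := by
      rw [← integral_add_right_eq_self (fun x => v (x - e) * pd g j x) e]
      simp
    have A3 := integral_pd_mul_eq_neg hv hvc hg j
    have I1 : Integrable fun x => pd v j x * g (x + e) :=
      ((cont j hv).mul hgt.continuous).integrable_of_hasCompactSupport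
        (HasCompactSupport.mul_right (hvc.fderiv_apply ℝ _))
    have I2 : Integrable fun x => pd v j x * g x :=
      ((cont j hv).mul hg.continuous).integrable_of_hasCompactSupport
        (HasCompactSupport.mul_right (hvc.fderiv_apply ℝ _))
    have I3 : Integrable fun x => v (x - e) * pd g j x :=
      ((hv.continuous.comp (continuous_id.sub continuous_const)).mul
        (cont j hg)).integrable_of_hasCompactSupport
        (HasCompactSupport.mul_left (hgc.fderiv_apply ℝ _))
    have I4 : Integrable fun x => v x * pd g j x :=
      (hv.continuous.mul (cont j hg)).integrable_of_hasCompactSupport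
        (HasCompactSupport.mul_left (hgc.fderiv_apply ℝ _))
    calc ∫ x, t⁻¹ • (g (x + e) - g x) * pd v j x
        = ∫ x, t⁻¹ * (pd v j x * g (x + e) - pd v j x * g x) := by
          congr 1; ext x; simp only [smul_eq_mul]; ring
      _ = t⁻¹ * ((∫ x, pd v j x * g (x + e)) - ∫ x, pd v j x * g x) := by
          rw [integral_const_mul, integral_sub I1 I2]
      _ = - (t⁻¹ * ((∫ x, v (x - e) * pd g j x) - ∫ x, v x * pd g j x)) := by
          rw [A1, A2, A3]; ring
      _ = - ∫ x, t⁻¹ * (v (x - e) * pd g j x - v x * pd g j x) := by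
          rw [integral_const_mul, integral_sub I3 I4]
      _ = _ := by
          congr 2; ext x
          rw [smul_neg, ← sub_eq_add_neg, smul_eq_mul]; ring
  simp only [key] at T1
  have h := tendsto_nhds_unique T1 T2.neg
  have lg : ∀ x, lineDeriv ℝ g x (EuclideanSpace.single i 1) = pd g i x := fun x =>
    (hg.differentiable (by norm_num) x).lineDeriv_eq_fderiv
  have lv : ∀ x, lineDeriv ℝ v x (-EuclideanSpace.single i 1) = - pd v i x := fun x => by
    rw [(hv.differentiable (by norm_num) x).lineDeriv_eq_fderiv, map_neg]; rfl
  simp only [lg, lv, neg_mul, integral_neg, neg_neg] at h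
  rw [← h]
  simp only [mul_comm]

lemma integral_pd_mul_pd_comm (hΩ : IsOpen Ω) {v g : Eu n → ℝ}
    (hv : ∀ x ∈ Ω, ContDiffAt ℝ 1 v x) (hg : ContDiff ℝ 1 g)
    (hgc : HasCompactSupport g) (hgΩ : tsupport g ⊆ Ω) (i j : Fin n) :
    ∫ x, pd v j x * pd g i x = ∫ x, pd v i x * pd g j x := by
  obtain ⟨L, hL, hKL, hLΩ⟩ := exists_compact_between hgc hΩ hgΩ
  obtain ⟨χ, h1, h0, -⟩ := exists_contMDiffMap_one_nhds_of_subset_interior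
    (n := 1) (modelWithCornersSelf ℝ (Eu n)) (isClosed_tsupport g) hKL
  have hχ : ContDiff ℝ 1 χ := χ.contMDiff.contDiff
  have hs : tsupport (fun x => χ x * v x) ⊆ L := by
    refine closure_minimal ?_ hL.isClosed
    intro x hx
    by_contra h
    exact hx (by simp [h0 x h])
  have hc : HasCompactSupport (fun x => χ x * v x) := hL.of_isClosed_subset (isClosed_tsupport _) hs
  have hcd : ContDiff ℝ 1 (fun x => χ x * v x) := by
    refine contDiff_of_forall_mem_tsupport (k := 1) fun x hx => hχ.contDiffAt.mul (hv x (hLΩ (hs hx)))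
  have hpd : ∀ x ∈ tsupport g, ∀ k, pd (fun x => χ x * v x) k x = pd v k x := by
    intro x hx k
    refine pd_congr ?_ k
    have : ∀ᶠ y in 𝓝 x, χ y = 1 := h1.filter_mono (nhds_le_nhdsSet hx)
    filter_upwards [this] with y hy
    simp [hy]
  have hpe : ∀ a c : Fin n, ∀ x, pd v a x * pd g c x = pd (fun x => χ x * v x) a x * pd g c x := by
    intro a c x
    by_cases hx : x ∈ tsupport g
    · rw [hpd x hx]
    · simp [pd_eq_zero_of_notMem hx]
  simp only [hpe]
  exact integral_pd_mul_pd_comm_of_compact hcd hc hg hgc i j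

end IntegrationByParts
lemma sum_energy_identity {n : ℕ} (l : Fin n) (φ w r b : ℝ) (p q : Fin n → ℝ)
    (H : Fin n → Fin n → ℝ) (hH : ∀ i j, H i j = H j i) :
    φ * (w * ((-(∑ i, H i i) - b * p l * r) ^ 2 - ∑ i, ∑ j, H i j ^ 2 - b * (p l * r) ^ 2))
      - w * ∑ i, q i * ((-(∑ i, H i i) - b * p l * r) * p i + ∑ j, p j * H i j)
    = (∑ i, ∑ j, (φ * w * (H i i * H j j - H i j ^ 2)
        + (φ * (if i = l then b * (w * r) else 0) + q i * w) * p i * H j j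
        - (φ * (if j = l then b * (w * r) else 0) + q j * w) * p i * H i j))
      + b * ∑ i, ((φ * (if i = l then (b - 1) * (w * r * r) else 0) + q i * (w * r)) * p l * p i
        + φ * (w * r) * H i l * p i + φ * (w * r) * p l * H i i) := by
  set L := ∑ i, H i i with hL
  have s1 : ∑ i, ∑ j, φ * w * (H i i * H j j) = φ * w * (L * L) := by
    rw [hL, Finset.sum_mul_sum]; simp only [Finset.mul_sum]
  have s2 : ∑ i, ∑ j, φ * w * H i j ^ 2 = φ * w * ∑ i, ∑ j, H i j ^ 2 := by
    simp only [Finset.mul_sum]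
  have s3 : ∑ i, ∑ j, (φ * (if i = l then b * (w * r) else 0)) * p i * H j j
      = φ * (b * (w * r)) * p l * L := by
    simp only [← Finset.mul_sum, ← hL, ← Finset.sum_mul]
    simp
  have s4 : ∑ i, ∑ j, q i * w * p i * H j j = w * (∑ i, q i * p i) * L := by
    simp only [← Finset.mul_sum, ← hL, ← Finset.sum_mul]
    congr 1
    rw [Finset.mul_sum]
    exact Finset.sum_congr rfl fun i _ => by ring
  have s5 : ∑ i, ∑ j, (φ * (if j = l then b * (w * r) else 0)) * p i * H i j
      = φ * (b * (w * r)) * ∑ i, p i * H i l := by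
    simp only [mul_ite, ite_mul, mul_zero, zero_mul,
      Finset.sum_ite_eq', Finset.mem_univ, if_true, Finset.mul_sum]
    exact Finset.sum_congr rfl fun i _ => by ring
  have s6 : ∑ i, ∑ j, q j * w * p i * H i j = w * ∑ i, q i * ∑ j, p j * H i j := by
    rw [Finset.sum_comm]
    simp only [Finset.mul_sum]
    exact Finset.sum_congr rfl fun i _ => Finset.sum_congr rfl fun j _ => by rw [hH j i]; ring
  have s7 : ∑ i, (φ * (if i = l then (b - 1) * (w * r * r) else 0)) * p l * p i
      = φ * ((b - 1) * (w * r * r)) * p l * p l := by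
    simp only [mul_ite, ite_mul, mul_zero, zero_mul, Finset.sum_ite_eq', Finset.mem_univ, if_true]
  have s8 : ∑ i, q i * (w * r) * p l * p i = w * r * p l * ∑ i, q i * p i := by
    rw [Finset.mul_sum]
    exact Finset.sum_congr rfl fun i _ => by ring
  have s9 : ∑ i, φ * (w * r) * H i l * p i = φ * (w * r) * ∑ i, p i * H i l := by
    rw [Finset.mul_sum]
    exact Finset.sum_congr rfl fun i _ => by ring
  have s10 : ∑ i, φ * (w * r) * p l * H i i = φ * (w * r) * p l * L := by
    rw [hL, Finset.mul_sum]
  have s11 : ∑ i, q i * ((-L - b * p l * r) * p i + ∑ j, p j * H i j)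
      = (-L - b * p l * r) * (∑ i, q i * p i) + ∑ i, q i * ∑ j, p j * H i j := by
    rw [Finset.mul_sum, ← Finset.sum_add_distrib]
    exact Finset.sum_congr rfl fun i _ => by ring
  rw [s11]
  simp only [add_mul, mul_sub (φ * w), Finset.sum_add_distrib, Finset.sum_sub_distrib]
  rw [s1, s2, s3, s4, s5, s6, s7, s8, s9, s10]
  ring

section EnergyIdentity

variable {n : ℕ} {Ω : Set (Eu n)} {u η : Eu n → ℝ}

lemma continuousAt_pd {v : Eu n → ℝ} {x : Eu n} (h : ContDiffAt ℝ 1 v x) (i : Fin n) :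
    ContinuousAt (pd v i) x :=
  (contDiffAt_pd (k := 0) (by simpa using h) i).continuousAt

lemma contDiffAt_one_pd {v : Eu n → ℝ} {x : Eu n} (h : ContDiffAt ℝ 2 v x) (i : Fin n) :
    ContDiffAt ℝ 1 (pd v i) x := by
  exact_mod_cast contDiffAt_pd (k := 1) (by exact_mod_cast h) i

lemma tsupport_mul_subset_of_left {f g : Eu n → ℝ} :
    tsupport (fun x => f x * g x) ⊆ tsupport f :=
  closure_mono fun _ hx h => hx (by simp [h])

lemma integral_hessian_minor (hΩ : IsOpen Ω) (hu : ∀ x ∈ Ω, ContDiffAt ℝ 2 u x)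
    (hη : ContDiff ℝ 1 η) (hηc : HasCompactSupport η) (hηΩ : tsupport η ⊆ Ω) (i j : Fin n) :
    Integrable (fun x => η x * (pd2 u i i x * pd2 u j j x - pd2 u i j x ^ 2)
      + pd η i x * pd u i x * pd2 u j j x - pd η j x * pd u i x * pd2 u i j x) ∧
    ∫ x, (η x * (pd2 u i i x * pd2 u j j x - pd2 u i j x ^ 2)
      + pd η i x * pd u i x * pd2 u j j x - pd η j x * pd u i x * pd2 u i j x) = 0 := by
  have cu : ∀ k, ∀ x ∈ tsupport η, ContinuousAt (pd u k) x := fun k x hx =>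
    continuousAt_pd ((hu x (hηΩ hx)).of_le (by norm_num)) k
  have cu2 : ∀ k l, ∀ x ∈ tsupport η, ContinuousAt (pd2 u k l) x := fun k l x hx =>
    continuousAt_pd (contDiffAt_one_pd (hu x (hηΩ hx)) l) k
  have ce : ∀ x, ContinuousAt η x := fun x => hη.continuous.continuousAt
  have ce1 : ∀ k x, ContinuousAt (pd η k) x := fun k x => continuousAt_pd hη.contDiffAt k
  have hgs : tsupport (fun x => η x * pd u i x) ⊆ tsupport η := tsupport_mul_subset_of_left
  have hg : ContDiff ℝ 1 fun x => η x * pd u i x :=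
    contDiff_of_forall_mem_tsupport (k := 1) fun x hx =>
      hη.contDiffAt.mul (contDiffAt_one_pd (hu x (hηΩ (hgs hx))) i)
  have hgc : HasCompactSupport fun x => η x * pd u i x := hηc.mul_right
  have main := integral_pd_mul_pd_comm hΩ (v := pd u j) (g := fun x => η x * pd u i x)
    (fun x hx => contDiffAt_one_pd (hu x hx) j) hg hgc (hgs.trans hηΩ) i j
  have expand : ∀ k l x, pd (pd u j) l x * pd (fun x => η x * pd u i x) k x
      = pd2 u l j x * (η x * pd2 u k i x + pd η k x * pd u i x) := by
    intro k l x
    by_cases hx : x ∈ tsupport η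
    · rw [pd_mul (hη.differentiable (by norm_num) x)
        ((contDiffAt_one_pd (hu x (hηΩ hx)) i).differentiableAt (by norm_num))]
      rfl
    · rw [pd_eq_zero_of_notMem (fun h => hx (hgs h)), pd_eq_zero_of_notMem hx,
        image_eq_zero_of_notMem_tsupport hx]
      ring
  simp only [expand] at main
  have I : ∀ k l, Integrable fun x => pd2 u l j x * (η x * pd2 u k i x + pd η k x * pd u i x) := by
    intro k l
    refine integrable_of_continuousAt hηc (fun x hx => ?_) (fun x hx => ?_)
    · exact (cu2 l j x hx).mul (((ce x).mul (cu2 k i x hx)).add ((ce1 k x).mul (cu i x hx)))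
    · rw [pd_eq_zero_of_notMem hx, image_eq_zero_of_notMem_tsupport hx]
      ring
  have eq : ∀ x, η x * (pd2 u i i x * pd2 u j j x - pd2 u i j x ^ 2)
      + pd η i x * pd u i x * pd2 u j j x - pd η j x * pd u i x * pd2 u i j x
      = pd2 u j j x * (η x * pd2 u i i x + pd η i x * pd u i x)
        - pd2 u i j x * (η x * pd2 u j i x + pd η j x * pd u i x) := by
    intro x
    by_cases hx : x ∈ tsupport η
    · rw [pd2_comm (hu x (hηΩ hx)) j i]
      ring
    · rw [pd_eq_zero_of_notMem hx, pd_eq_zero_of_notMem hx, image_eq_zero_of_notMem_tsupport hx]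
      ring
  simp only [eq]
  refine ⟨(I i j).sub (I j i), ?_⟩
  rw [integral_sub (I i j) (I j i), main, sub_self]

lemma integral_div_gradient_mul_pd (hu : ∀ x ∈ Ω, ContDiffAt ℝ 2 u x)
    (hη : ContDiff ℝ 1 η) (hηc : HasCompactSupport η) (hηΩ : tsupport η ⊆ Ω) (i l : Fin n) :
    Integrable (fun x => pd η i x * pd u l x * pd u i x + η x * pd2 u i l x * pd u i x
      + η x * pd u l x * pd2 u i i x) ∧
    ∫ x, (pd η i x * pd u l x * pd u i x + η x * pd2 u i l x * pd u i x
      + η x * pd u l x * pd2 u i i x) = 0 := by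
  have hgs : tsupport (fun x => η x * (pd u l x * pd u i x)) ⊆ tsupport η :=
    tsupport_mul_subset_of_left
  have hg : ContDiff ℝ 1 fun x => η x * (pd u l x * pd u i x) :=
    contDiff_of_forall_mem_tsupport (k := 1) fun x hx =>
      hη.contDiffAt.mul ((contDiffAt_one_pd (hu x (hηΩ (hgs hx))) l).mul
        (contDiffAt_one_pd (hu x (hηΩ (hgs hx))) i))
  have hgc : HasCompactSupport fun x => η x * (pd u l x * pd u i x) := hηc.mul_right
  have eq : ∀ x, pd η i x * pd u l x * pd u i x + η x * pd2 u i l x * pd u i x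
      + η x * pd u l x * pd2 u i i x = pd (fun x => η x * (pd u l x * pd u i x)) i x := by
    intro x
    by_cases hx : x ∈ tsupport η
    · have dl := (contDiffAt_one_pd (hu x (hηΩ hx)) l).differentiableAt (by norm_num)
      have di := (contDiffAt_one_pd (hu x (hηΩ hx)) i).differentiableAt (by norm_num)
      rw [pd_mul (w := fun y => pd u l y * pd u i y) (hη.differentiable (by norm_num) x)
        (dl.mul di), pd_mul dl di]
      simp only [pd2]
      ring
    · rw [pd_eq_zero_of_notMem (fun h => hx (hgs h)), pd_eq_zero_of_notMem hx,
        image_eq_zero_of_notMem_tsupport hx]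
      ring
  simp only [eq]
  refine ⟨Continuous.integrable_of_hasCompactSupport ?_ (hgc.fderiv_apply ℝ _),
    integral_pd_eq_zero hg hgc i⟩
  exact (hg.continuous_fderiv (by norm_num)).clm_apply continuous_const

lemma isOpen_halfSpace (l : Fin n) : IsOpen {x : Eu n | 0 < x l} :=
  isOpen_lt continuous_const (EuclideanSpace.proj l).continuous

lemma hasFDerivAt_rpow_coord (l : Fin n) (b : ℝ) {x : Eu n} (hx : 0 < x l) :
    HasFDerivAt (fun y : Eu n => y l ^ b)
      ((b * x l ^ (b - 1)) • (EuclideanSpace.proj l : Eu n →L[ℝ] ℝ)) x := by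
  exact (Real.hasDerivAt_rpow_const (Or.inl hx.ne')).comp_hasFDerivAt x
    (EuclideanSpace.proj (𝕜 := ℝ) l).hasFDerivAt

lemma contDiffAt_rpow_coord (l : Fin n) (b : ℝ) {x : Eu n} (hx : 0 < x l) :
    ContDiffAt ℝ 1 (fun y : Eu n => y l ^ b) x :=
  ContDiffAt.rpow_const_of_ne (EuclideanSpace.proj (𝕜 := ℝ) l).contDiff.contDiffAt hx.ne'

lemma pd_rpow_coord (l : Fin n) (b : ℝ) {x : Eu n} (hx : 0 < x l) (i : Fin n) :
    pd (fun y : Eu n => y l ^ b) i x = if i = l then b * x l ^ (b - 1) else 0 := by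
  simp only [pd, (hasFDerivAt_rpow_coord l b hx).fderiv]
  by_cases h : i = l
  · simp [h]
  · simp [h, Ne.symm h]

/-- The weighted energy identity tested against a compactly supported cutoff. -/
lemma integral_cutoff_energy (l : Fin n) (b : ℝ)
    (hu : ∀ x ∈ {x : Eu n | 0 < x l}, ContDiffAt ℝ 2 u x)
    {f φ : Eu n → ℝ} (hφ : ContDiff ℝ 1 φ) (hφc : HasCompactSupport φ)
    (hφH : tsupport φ ⊆ {x : Eu n | 0 < x l})
    (heq : ∀ x : Eu n, 0 < x l → -(∑ i, pd2 u i i x) - b * pd u l x / x l = f x) :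
    ∫ x, (φ x * (x l ^ b * (f x ^ 2 - ∑ i, ∑ j, pd2 u i j x ^ 2 - b * (pd u l x / x l) ^ 2))
      - x l ^ b * ∑ i, pd φ i x * (f x * pd u i x + ∑ j, pd u j x * pd2 u i j x)) = 0 := by
  have weight : ∀ c : ℝ, ContDiff ℝ 1 (fun x => φ x * x l ^ c) ∧
      HasCompactSupport (fun x => φ x * x l ^ c) ∧
      tsupport (fun x => φ x * x l ^ c) ⊆ {x : Eu n | 0 < x l} := by
    intro c
    have hs : tsupport (fun x => φ x * x l ^ c) ⊆ tsupport φ := tsupport_mul_subset_of_left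
    exact ⟨contDiff_of_forall_mem_tsupport (k := 1) fun x hx =>
      hφ.contDiffAt.mul (contDiffAt_rpow_coord l c (hφH (hs hx))), hφc.mul_right, hs.trans hφH⟩
  obtain ⟨hη, hηc, hηH⟩ := weight b
  obtain ⟨hζ, hζc, hζH⟩ := weight (b - 1)
  have M := fun i j => integral_hessian_minor (isOpen_halfSpace l) hu hη hηc hηH i j
  have D := fun i => integral_div_gradient_mul_pd hu hζ hζc hζH i l
  have S : ∫ x, ((∑ i, ∑ j, (φ x * x l ^ b * (pd2 u i i x * pd2 u j j x - pd2 u i j x ^ 2)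
      + pd (fun x => φ x * x l ^ b) i x * pd u i x * pd2 u j j x
      - pd (fun x => φ x * x l ^ b) j x * pd u i x * pd2 u i j x))
      + b * ∑ i, (pd (fun x => φ x * x l ^ (b - 1)) i x * pd u l x * pd u i x
        + φ x * x l ^ (b - 1) * pd2 u i l x * pd u i x
        + φ x * x l ^ (b - 1) * pd u l x * pd2 u i i x)) = 0 := by
    rw [integral_add, integral_const_mul, integral_finsetSum, integral_finsetSum]
    · have h1 : ∀ i, ∫ x, ∑ j, (φ x * x l ^ b * (pd2 u i i x * pd2 u j j x - pd2 u i j x ^ 2)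
          + pd (fun x => φ x * x l ^ b) i x * pd u i x * pd2 u j j x
          - pd (fun x => φ x * x l ^ b) j x * pd u i x * pd2 u i j x) = 0 := by
        intro i
        rw [integral_finsetSum _ fun j _ => (M i j).1]
        exact Finset.sum_eq_zero fun j _ => (M i j).2
      rw [Finset.sum_eq_zero fun i _ => h1 i, Finset.sum_eq_zero fun i _ => (D i).2]
      simp
    · exact fun i _ => (D i).1
    · exact fun i _ => integrable_finsetSum _ fun j _ => (M i j).1
    · exact integrable_finsetSum _ fun i _ => integrable_finsetSum _ fun j _ => (M i j).1
    · exact (integrable_finsetSum _ fun i _ => (D i).1).const_mul b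
  rw [← S]
  congr 1
  ext x
  by_cases hx : x ∈ tsupport φ
  · have hx0 : 0 < x l := hφH hx
    have dφ := hφ.differentiable (by norm_num) x
    have e1 : ∀ c i, pd (fun x => φ x * x l ^ c) i x
        = φ x * (if i = l then c * x l ^ (c - 1) else 0) + pd φ i x * x l ^ c := by
      intro c i
      rw [pd_mul dφ ((contDiffAt_rpow_coord l c hx0).differentiableAt (by norm_num)),
        pd_rpow_coord l c hx0]
    have w1 : x l ^ (b - 1) = x l ^ b * (x l)⁻¹ := by
      rw [Real.rpow_sub_one hx0.ne']; rfl
    have w2 : x l ^ (b - 1 - 1) = x l ^ b * (x l)⁻¹ * (x l)⁻¹ := by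
      rw [Real.rpow_sub_one hx0.ne', w1]; rfl
    simp only [e1, ← heq x hx0, w2, w1]
    generalize x l ^ b = w
    simp only [div_eq_mul_inv]
    generalize (x l)⁻¹ = r
    exact sum_energy_identity l (φ x) w r b (fun i => pd u i x) (fun i => pd φ i x)
      (fun i j => pd2 u i j x) fun i j => pd2_comm (hu x hx0) i j
  · have e0 : ∀ c : ℝ, (fun x => φ x * x l ^ c) =ᶠ[𝓝 x] fun _ => 0 := by
      intro c
      filter_upwards [notMem_tsupport_iff_eventuallyEq.1 hx] with y hy
      simp [hy]
    have e1 : ∀ (c : ℝ) i, pd (fun x => φ x * x l ^ c) i x = 0 := fun c i => by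
      rw [pd_congr (e0 c)]; simp [pd]
    simp [e1, pd_eq_zero_of_notMem hx, image_eq_zero_of_notMem_tsupport hx]

end EnergyIdentity

section Cutoff

variable {n : ℕ}

lemma exists_bound_deriv_smoothTransition :
    ∃ C : ℝ, 0 ≤ C ∧ (∀ s, |deriv Real.smoothTransition s| ≤ C) ∧
      ∀ s, 1 < s → deriv Real.smoothTransition s = 0 := by
  have h1 : ∀ s, 1 < s → deriv Real.smoothTransition s = 0 := by
    intro s hs
    have : Real.smoothTransition =ᶠ[𝓝 s] fun _ => 1 := by
      filter_upwards [lt_mem_nhds hs] with y hy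
      exact Real.smoothTransition.one_of_one_le hy.le
    rw [this.deriv_eq, deriv_const]
  have h0 : ∀ s, s < 0 → deriv Real.smoothTransition s = 0 := by
    intro s hs
    have : Real.smoothTransition =ᶠ[𝓝 s] fun _ => 0 := by
      filter_upwards [gt_mem_nhds hs] with y hy
      exact Real.smoothTransition.zero_of_nonpos hy.le
    rw [this.deriv_eq, deriv_const]
  have hc : Continuous (deriv Real.smoothTransition) :=
    (Real.smoothTransition.contDiff (n := 1)).continuous_deriv (by norm_num)
  obtain ⟨C, hC⟩ := (isCompact_Icc (a := (0 : ℝ)) (b := 1)).exists_bound_of_continuousOn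
    hc.continuousOn
  have hC0 : 0 ≤ C := (norm_nonneg _).trans (hC 0 (by simp))
  refine ⟨C, hC0, fun s => ?_, h1⟩
  rcases lt_or_ge s 0 with hs | hs
  · simpa [h0 s hs] using hC0
  rcases lt_or_ge 1 s with hs' | hs'
  · simpa [h1 s hs'] using hC0
  exact hC s ⟨hs, hs'⟩

/-- Cutoffs to compact subsets of the half-space; their gradients are bounded by a multiple of
`1 + 1 / x_l`, where the second term is needed only for `x_l < 1`. -/
lemma exists_halfSpace_cutoff (l : Fin n) :
    ∃ (φ : ℕ → Eu n → ℝ) (C : ℝ), 0 ≤ C ∧ (∀ m, ContDiff ℝ 1 (φ m)) ∧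
      (∀ m, HasCompactSupport (φ m)) ∧ (∀ m, tsupport (φ m) ⊆ {x : Eu n | 0 < x l}) ∧
      (∀ m x, |φ m x| ≤ 1) ∧
      (∀ x : Eu n, 0 < x l → ∀ᶠ m in atTop, φ m x = 1 ∧ ∀ i, pd (φ m) i x = 0) ∧
      ∀ m (x : Eu n) i, 0 < x l →
        |pd (φ m) i x| ≤ C * (1 + if x l < 1 then (x l)⁻¹ else 0) := by
  obtain ⟨Cs, hCs0, hCs, hCs1⟩ := exists_bound_deriv_smoothTransition
  let c : ContDiffBump (0 : Eu n) := ⟨1, 2, one_pos, one_lt_two⟩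
  have hcd : ContDiff ℝ 1 c := c.contDiff
  obtain ⟨Cc, hCc⟩ := (c.hasCompactSupport.fderiv ℝ).exists_bound_of_continuous
    (hcd.continuous_fderiv (by norm_num))
  have hCc0 : 0 ≤ Cc := (norm_nonneg _).trans (hCc 0)
  let N : ℕ → ℝ := fun m => (m : ℝ) + 3
  have hN : ∀ m, 3 ≤ N m := fun m => by simp [N]
  have hN0 : ∀ m, 0 < N m := fun m => by linarith [hN m]
  let a : ℕ → Eu n → ℝ := fun m x => Real.smoothTransition (N m * x l - 1)
  let d : ℕ → Eu n → ℝ := fun m x => c ((N m)⁻¹ • x)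
  have ha : ∀ m, ContDiff ℝ 1 (a m) := fun m =>
    Real.smoothTransition.contDiff.comp
      ((contDiff_const.mul (EuclideanSpace.proj (𝕜 := ℝ) l).contDiff).sub contDiff_const)
  have hd : ∀ m, ContDiff ℝ 1 (d m) := fun m => hcd.comp (contDiff_const_smul _)
  have ha1 : ∀ m x, |a m x| ≤ 1 := fun m x => by
    rw [abs_of_nonneg (Real.smoothTransition.nonneg _)]
    exact Real.smoothTransition.le_one _
  have hd1 : ∀ m x, |d m x| ≤ 1 := fun m x => by
    rw [abs_of_nonneg c.nonneg]
    exact c.le_one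
  have hs : ∀ m, tsupport (fun x => a m x * d m x) ⊆
      {x | (N m)⁻¹ ≤ x l} ∩ Metric.closedBall 0 (2 * N m) := by
    intro m
    refine closure_minimal ?_ (IsClosed.inter ?_ Metric.isClosed_closedBall)
    · intro x hx
      have hx' : a m x ≠ 0 ∧ d m x ≠ 0 := mul_ne_zero_iff.1 hx
      constructor
      · by_contra h
        refine hx'.1 (Real.smoothTransition.zero_of_nonpos ?_)
        have h' : x l < (N m)⁻¹ := not_le.1 h
        have := mul_lt_mul_of_pos_left h' (hN0 m)
        rw [mul_inv_cancel₀ (hN0 m).ne'] at this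
        linarith
      · have h2 : (N m)⁻¹ • x ∈ Function.support c := hx'.2
        rw [c.support_eq, mem_ball_zero_iff, norm_smul, norm_inv, Real.norm_of_nonneg (hN0 m).le,
          inv_mul_lt_iff₀ (hN0 m)] at h2
        rw [mem_closedBall_zero_iff, mul_comm]
        exact h2.le
    · exact isClosed_le continuous_const (EuclideanSpace.proj (𝕜 := ℝ) l).continuous
  refine ⟨fun m x => a m x * d m x, Cc + 2 * Cs, by positivity, fun m => (ha m).mul (hd m), fun m =>
    (isCompact_closedBall _ _).of_isClosed_subset (isClosed_tsupport _)
      ((hs m).trans Set.inter_subset_right), fun m x hx => ?_, fun m x => ?_, fun x hx => ?_,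
    fun m x i hx => ?_⟩
  · exact (inv_pos.2 (hN0 m)).trans_le (hs m hx).1
  · rw [abs_mul]
    exact mul_le_one₀ (ha1 m x) (abs_nonneg _) (hd1 m x)
  · have tN : Tendsto N atTop atTop :=
      tendsto_atTop_add_const_right _ _ tendsto_natCast_atTop_atTop
    filter_upwards [tN.eventually_gt_atTop (2 / x l), tN.eventually_gt_atTop ‖x‖] with m h1 h2
    have hloc : (fun y => a m y * d m y) =ᶠ[𝓝 x] fun _ => 1 := by
      have o1 : ∀ᶠ y : Eu n in 𝓝 x, 2 / N m < y l :=
        (EuclideanSpace.proj (𝕜 := ℝ) l).continuous.continuousAt.eventually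
          (lt_mem_nhds ((div_lt_comm₀ hx (hN0 m)).1 h1))
      have o2 : ∀ᶠ y : Eu n in 𝓝 x, ‖y‖ < N m :=
        continuous_norm.continuousAt.eventually (gt_mem_nhds h2)
      filter_upwards [o1, o2] with y h3 h4
      have e1 : a m y = 1 := by
        refine Real.smoothTransition.one_of_one_le ?_
        rw [div_lt_iff₀ (hN0 m)] at h3
        linarith
      have e2 : d m y = 1 := by
        refine c.one_of_mem_closedBall ?_
        rw [mem_closedBall_zero_iff, norm_smul, norm_inv, Real.norm_of_nonneg (hN0 m).le,
          inv_mul_le_iff₀ (hN0 m)]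
        simpa [c] using h4.le
      rw [e1, e2, one_mul]
    refine ⟨hloc.self_of_nhds, fun i => ?_⟩
    rw [pd_congr hloc]
    simp [pd]
  · have pdd : |pd (d m) i x| ≤ Cc := by
      have h1 : HasFDerivAt (d m) ((fderiv ℝ c ((N m)⁻¹ • x)).comp
          ((N m)⁻¹ • ContinuousLinearMap.id ℝ (Eu n))) x :=
        (hcd.differentiable (by norm_num) _).hasFDerivAt.comp x
          ((hasFDerivAt_id x).const_smul (N m)⁻¹)
      have h2 : pd (d m) i x
          = (N m)⁻¹ * fderiv ℝ c ((N m)⁻¹ • x) (EuclideanSpace.single i 1) := by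
        simp [pd, h1.fderiv]
      have h3 : |fderiv ℝ c ((N m)⁻¹ • x) (EuclideanSpace.single i 1)| ≤ Cc := by
        refine ((fderiv ℝ c ((N m)⁻¹ • x)).le_opNorm _).trans ?_
        simpa using hCc ((N m)⁻¹ • x)
      rw [h2, abs_mul, abs_of_pos (inv_pos.2 (hN0 m))]
      have h4 : (N m)⁻¹ ≤ 1 := inv_le_one_of_one_le₀ (by linarith [hN m])
      calc _ ≤ 1 * Cc := by gcongr
        _ = Cc := one_mul _
    have pda : |pd (a m) i x| ≤ 2 * Cs * if x l < 1 then (x l)⁻¹ else 0 := by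
      have h1 : HasFDerivAt (a m) (deriv Real.smoothTransition (N m * x l - 1) •
          (N m • (EuclideanSpace.proj l : Eu n →L[ℝ] ℝ))) x := by
        have h0 : HasDerivAt Real.smoothTransition
            (deriv Real.smoothTransition (N m * x l - 1)) (N m * x l - 1) :=
          ((Real.smoothTransition.contDiff (n := 1)).differentiable (by norm_num) _).hasDerivAt
        exact h0.comp_hasFDerivAt x
          (((EuclideanSpace.proj (𝕜 := ℝ) l).hasFDerivAt.const_mul (N m)).sub_const 1)
      have h2 : pd (a m) i x = deriv Real.smoothTransition (N m * x l - 1) *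
          (N m * (EuclideanSpace.single i (1 : ℝ) : Eu n) l) := by
        simp [pd, h1.fderiv]
      have h3 : |(EuclideanSpace.single i (1 : ℝ) : Eu n) l| ≤ 1 := by
        by_cases h : l = i <;> simp [h]
      rcases lt_or_ge 1 (N m * x l - 1) with h4 | h4
      · rw [h2, hCs1 _ h4, zero_mul, abs_zero]
        split_ifs <;> positivity
      · have h5 : N m ≤ 2 * (x l)⁻¹ := by
          rw [← div_eq_mul_inv, le_div_iff₀ hx]; linarith
        have h6 : x l < 1 := by nlinarith [hN m]
        rw [h2, abs_mul, abs_mul, abs_of_pos (hN0 m), if_pos h6]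
        calc _ ≤ Cs * ((2 * (x l)⁻¹) * 1) := by gcongr; exact hCs _
          _ = _ := by ring
    rw [pd_mul ((ha m).differentiable (by norm_num) x) ((hd m).differentiable (by norm_num) x)]
    calc |a m x * pd (d m) i x + pd (a m) i x * d m x|
        ≤ |a m x| * |pd (d m) i x| + |pd (a m) i x| * |d m x| := by
          rw [← abs_mul, ← abs_mul]; exact abs_add_le _ _
      _ ≤ 1 * Cc + (2 * Cs * if x l < 1 then (x l)⁻¹ else 0) * 1 := by
          gcongr
          · exact ha1 m x
          · exact hd1 m x
      _ ≤ _ := by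
          have : 0 ≤ if x l < 1 then (x l)⁻¹ else 0 := by split_ifs <;> positivity
          nlinarith [mul_nonneg hCc0 this]

end Cutoff

section Weights

variable {n : ℕ}

lemma measurable_coord (l : Fin n) : Measurable fun x : Eu n => x l :=
  (EuclideanSpace.proj (𝕜 := ℝ) l).continuous.measurable

lemma integrableOn_rpow_mul_one_add_norm (hn : 2 ≤ n) (l : Fin n) {b : ℝ} (hb : 0 < b) :
    IntegrableOn (fun x : Eu n => x l ^ b * (1 + ‖x‖) ^ (-(2 * n - 1 + 2 * b)))
      {x : Eu n | 0 < x l} := by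
  have hn' : (2 : ℝ) ≤ n := by exact_mod_cast hn
  have h := integrable_one_add_norm (μ := (volume : Measure (Eu n))) (r := 2 * n - 1 + b)
    (by simp; linarith)
  refine Integrable.mono' h.integrableOn ?_ ?_
  · have := measurable_coord l
    exact Measurable.aestronglyMeasurable (by fun_prop)
  · refine (ae_restrict_iff' (isOpen_halfSpace l).measurableSet).2 (Eventually.of_forall ?_)
    intro x (hx : 0 < x l)
    have h0 : 0 < 1 + ‖x‖ := by positivity
    rw [Real.norm_of_nonneg (by positivity)]
    have h1 : x l ≤ 1 + ‖x‖ := by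
      have := PiLp.norm_apply_le x l
      linarith [Real.le_norm_self (x l)]
    calc x l ^ b * (1 + ‖x‖) ^ (-(2 * n - 1 + 2 * b))
        ≤ (1 + ‖x‖) ^ b * (1 + ‖x‖) ^ (-(2 * n - 1 + 2 * b)) := by gcongr
      _ = (1 + ‖x‖) ^ (-(2 * n - 1 + b)) := by
        rw [← Real.rpow_add h0]; congr 1; ring

lemma integrableOn_rpow_div_mul_one_add_norm (hn : 2 ≤ n) (l : Fin n) {b : ℝ} (hb : 0 < b) :
    IntegrableOn (fun x : Eu n => (if x l < 1 then (x l)⁻¹ else 0) *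
      (x l ^ b * (1 + ‖x‖) ^ (-(2 * n - 1 + 2 * b)))) {x : Eu n | 0 < x l} := by
  have hn' : (2 : ℝ) ≤ n := by exact_mod_cast hn
  let g : Fin n → ℝ → ℝ := fun i t =>
    if i = l then (Set.Ioo (0 : ℝ) 1).indicator (fun t => t ^ (b - 1)) t else (1 + ‖t‖) ^ (-2 : ℝ)
  have hg : ∀ i, Integrable (g i) := by
    intro i
    by_cases hi : i = l
    · simp only [g, if_pos hi]
      rw [integrable_indicator_iff measurableSet_Ioo]
      exact (intervalIntegral.integrableOn_Ioo_rpow_iff one_pos).2 (by linarith)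
    · simp only [g, if_neg hi]
      exact integrable_one_add_norm (by simp)
  have hprod : Integrable fun x : Eu n => ∏ i, g i (x i) := by
    rw [← (PiLp.volume_preserving_toLp (Fin n)).integrable_comp_emb
      (MeasurableEquiv.toLp 2 _).measurableEmbedding]
    exact Integrable.fintype_prod hg
  refine Integrable.mono' hprod.integrableOn ?_ ?_
  · have := measurable_coord l
    refine Measurable.aestronglyMeasurable (Measurable.mul ?_ (by fun_prop))
    exact Measurable.ite (measurableSet_lt this measurable_const) this.inv measurable_const
  · refine (ae_restrict_iff' (isOpen_halfSpace l).measurableSet).2 (Eventually.of_forall ?_)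
    intro x (hx : 0 < x l)
    have h0 : 0 < 1 + ‖x‖ := by positivity
    have hg0 : ∀ i t, 0 ≤ g i t := by
      intro i t
      simp only [g]
      split_ifs
      · exact Set.indicator_nonneg (fun t ht => Real.rpow_nonneg ht.1.le _) t
      · positivity
    by_cases h1 : x l < 1
    · rw [if_pos h1, Real.norm_of_nonneg (by positivity),
        ← Finset.mul_prod_erase _ _ (Finset.mem_univ l), ← mul_assoc]
      have e1 : g l (x l) = (x l)⁻¹ * x l ^ b := by
        simp only [g, if_true]
        rw [Set.indicator_of_mem (show x l ∈ Set.Ioo (0 : ℝ) 1 from ⟨hx, h1⟩),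
          Real.rpow_sub_one hx.ne']
        ring
      rw [e1]
      gcongr
      calc (1 + ‖x‖) ^ (-(2 * n - 1 + 2 * b) : ℝ)
          ≤ (1 + ‖x‖) ^ ((-2 : ℝ) * ((n - 1 : ℕ) : ℝ)) := by
            refine Real.rpow_le_rpow_of_exponent_le (by linarith [norm_nonneg x]) ?_
            rw [Nat.cast_sub (by lia)]
            push_cast
            linarith
        _ = ∏ i ∈ Finset.univ.erase l, (1 + ‖x‖) ^ (-2 : ℝ) := by
            rw [Finset.prod_const, Finset.card_erase_of_mem (Finset.mem_univ l), Finset.card_univ,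
              Fintype.card_fin, Real.rpow_mul h0.le, Real.rpow_natCast]
        _ ≤ ∏ i ∈ Finset.univ.erase l, g i (x i) := by
            refine Finset.prod_le_prod (fun i _ => by positivity) fun i hi => ?_
            simp only [g, if_neg (Finset.ne_of_mem_erase hi)]
            refine Real.rpow_le_rpow_of_nonpos (by positivity) ?_ (by norm_num)
            linarith [PiLp.norm_apply_le x i]
    · rw [if_neg h1, zero_mul, norm_zero]
      exact Finset.prod_nonneg fun i _ => hg0 _ _

/-- Boundedness near the boundary, continuity and decay at infinity give a global decay bound. -/
lemma exists_global_decay (l : Fin n) {F : Eu n → ℝ} {s M A : ℝ} (hs : 0 ≤ s)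
    (hF : ContinuousOn F {x : Eu n | 0 < x l})
    (hM : ∀ x : Eu n, 0 < x l → x l < 1 → |F x| ≤ M)
    (hA : ∀ x : Eu n, 0 < x l → 2 < ‖x‖ → |F x| ≤ A / ‖x‖ ^ s) :
    ∃ K : ℝ, 0 ≤ K ∧ ∀ x : Eu n, 0 < x l → |F x| ≤ K * (1 + ‖x‖) ^ (-s) := by
  have hcomp : IsCompact (Metric.closedBall (0 : Eu n) 2 ∩ {x : Eu n | 1 ≤ x l}) :=
    (isCompact_closedBall _ _).inter_right
      (isClosed_le continuous_const (EuclideanSpace.proj (𝕜 := ℝ) l).continuous)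
  obtain ⟨C, hC⟩ := hcomp.exists_bound_of_continuousOn
    (hF.mono fun x hx => show 0 < x l from one_pos.trans_le hx.2)
  refine ⟨3 ^ s * (|M| + |C| + |A|), by positivity, fun x hx => ?_⟩
  have h0 : 0 < 1 + ‖x‖ := by positivity
  rw [Real.rpow_neg h0.le, ← div_eq_mul_inv, le_div_iff₀ (by positivity)]
  rcases le_or_gt ‖x‖ 2 with h2 | h2
  · have hFx : |F x| ≤ |M| + |C| + |A| := by
      rcases lt_or_ge (x l) 1 with h1 | h1
      · linarith [hM x hx h1, le_abs_self M, abs_nonneg C, abs_nonneg A]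
      · have := hC x ⟨mem_closedBall_zero_iff.2 h2, h1⟩
        rw [Real.norm_eq_abs] at this
        linarith [le_abs_self C, abs_nonneg M, abs_nonneg A]
    rw [mul_comm]
    gcongr
    linarith
  · have hx0 : 0 < ‖x‖ := by linarith
    have h3 : |F x| * ‖x‖ ^ s ≤ |M| + |C| + |A| := by
      have := hA x hx h2
      rw [le_div_iff₀ (by positivity)] at this
      linarith [le_abs_self A, abs_nonneg M, abs_nonneg C]
    calc |F x| * (1 + ‖x‖) ^ s ≤ |F x| * (3 * ‖x‖) ^ s := by
          gcongr
          linarith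
      _ = 3 ^ s * (|F x| * ‖x‖ ^ s) := by
          rw [Real.mul_rpow (by norm_num) hx0.le]; ring
      _ ≤ _ := by gcongr

end Weights

theorem stmt13 (n : ℕ) (hn : 2 ≤ n) (ln : Fin n) (hln : (ln : ℕ) = n - 1)
    (b : ℝ) (hb : 0 < b)
    (f u : Eu n → ℝ)
    -- f is bounded, measurable, supported in B₁(0) ∩ ℝⁿ₊
    (hfmeas : Measurable f) (hfbdd : ∃ M : ℝ, ∀ y, |f y| ≤ M)
    (hfsupp : ∀ y : Eu n, f y ≠ 0 → y ∈ Metric.ball (0 : Eu n) 1 ∧ 0 < y ln)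
    -- u ∈ C²(ℝⁿ₊) satisfies −Δu − b uₙ/xₙ = f
    (hC2 : ContDiffOn ℝ 2 u {x : Eu n | 0 < x ln})
    (heq : ∀ x : Eu n, 0 < x ln →
      -(∑ i, pd2 u i i x) - b * pd u ln x / x ln = f x)
    -- u, Du, D²u, uₙ/xₙ are bounded on ℝ^{n-1} × (0,1)
    (hbdd : ∃ M : ℝ, ∀ x : Eu n, 0 < x ln → x ln < 1 →
      |u x| ≤ M ∧ ‖fderiv ℝ u x‖ ≤ M ∧ ‖fderiv ℝ (fderiv ℝ u) x‖ ≤ M ∧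
        |pd u ln x / x ln| ≤ M)
    -- decay: ‖D^k u(x)‖ ≤ A/|x|^{n-2+b+k} for k = 0,1,2 and |x| > 2
    (A : ℝ)
    (hdecay : ∀ k : ℕ, k ≤ 2 → ∀ x : Eu n, 0 < x ln → 2 < ‖x‖ →
      ‖iteratedFDeriv ℝ k u x‖ ≤ A / ‖x‖ ^ ((n : ℝ) - 2 + b + k)) :
    -- energy identity ∫ Σ(∂ᵢⱼu)² dμ_b + b ∫ (uₙ/xₙ)² dμ_b = ∫ f² dμ_b
    (∫ x in {x : Eu n | 0 < x ln}, (∑ i, ∑ j, (pd2 u i j x) ^ 2) * (x ln) ^ b)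
      + b * (∫ x in {x : Eu n | 0 < x ln}, (pd u ln x / x ln) ^ 2 * (x ln) ^ b)
      = ∫ x in {x : Eu n | 0 < x ln}, (f x) ^ 2 * (x ln) ^ b := by
  have hopen := isOpen_halfSpace ln
  have hu : ∀ x ∈ {x : Eu n | 0 < x ln}, ContDiffAt ℝ 2 u x := fun x hx =>
    hC2.contDiffAt (hopen.mem_nhds hx)
  have hn' : (2 : ℝ) ≤ n := by exact_mod_cast hn
  have single_norm : ∀ i : Fin n, ‖(EuclideanSpace.single i (1 : ℝ) : Eu n)‖ = 1 := by simp
  have pd_le : ∀ x i, |pd u i x| ≤ ‖fderiv ℝ u x‖ := fun x i => by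
    simpa [single_norm, pd] using (fderiv ℝ u x).le_opNorm (EuclideanSpace.single i 1)
  have pd2_le : ∀ x : Eu n, 0 < x ln → ∀ i j, |pd2 u i j x| ≤ ‖fderiv ℝ (fderiv ℝ u) x‖ := by
    intro x hx i j
    rw [pd2_eq_fderiv_fderiv (hu x hx)]
    simpa [single_norm] using (fderiv ℝ (fderiv ℝ u) x).le_opNorm₂
      (EuclideanSpace.single i 1) (EuclideanSpace.single j 1)
  have c1 : ∀ i, ContinuousOn (pd u i) {x : Eu n | 0 < x ln} := fun i x hx =>
    (continuousAt_pd ((hu x hx).of_le (by norm_num)) i).continuousWithinAt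
  have c2 : ∀ i j, ContinuousOn (pd2 u i j) {x : Eu n | 0 < x ln} := fun i j x hx =>
    (continuousAt_pd (contDiffAt_one_pd (hu x hx) j) i).continuousWithinAt
  have cD : ContinuousOn (fun x => ‖fderiv ℝ u x‖) {x : Eu n | 0 < x ln} := fun x hx =>
    (((hu x hx).fderiv_right (m := 1) (by norm_num)).continuousAt).norm.continuousWithinAt
  have cD2 : ContinuousOn (fun x => ‖fderiv ℝ (fderiv ℝ u) x‖) {x : Eu n | 0 < x ln} :=
    fun x hx => ((((hu x hx).fderiv_right (m := 1) (by norm_num)).fderiv_right (m := 0)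
      (by norm_num)).continuousAt).norm.continuousWithinAt
  have cp : ContinuousOn (fun x : Eu n => pd u ln x / x ln) {x : Eu n | 0 < x ln} :=
    (c1 ln).div (EuclideanSpace.proj (𝕜 := ℝ) ln).continuous.continuousOn fun x hx => ne_of_gt hx
  obtain ⟨M, hM⟩ := hbdd
  obtain ⟨Mf, hMf⟩ := hfbdd
  have far2 : ∀ x : Eu n, 0 < x ln → 2 < ‖x‖ →
      ‖fderiv ℝ (fderiv ℝ u) x‖ ≤ A / ‖x‖ ^ ((n : ℝ) + b) := by
    intro x hx h2
    have := hdecay 2 le_rfl x hx h2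
    rw [← norm_iteratedFDeriv_fderiv, norm_iteratedFDeriv_one] at this
    convert this using 3
    push_cast; ring
  obtain ⟨K₁, hK₁, hb₁⟩ := exists_global_decay ln (F := fun x => ‖fderiv ℝ u x‖)
    (s := (n : ℝ) - 1 + b) (M := M) (A := A) (by linarith) cD
    (fun x hx h1 => by simpa using (hM x hx h1).2.1)
    (fun x hx h2 => by
      have := hdecay 1 one_le_two x hx h2
      rw [norm_iteratedFDeriv_one] at this
      rw [abs_of_nonneg (norm_nonneg _)]
      convert this using 3
      push_cast; ring)
  obtain ⟨K₂, hK₂, hb₂⟩ := exists_global_decay ln (F := fun x => ‖fderiv ℝ (fderiv ℝ u) x‖)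
    (s := (n : ℝ) + b) (M := M) (A := A) (by linarith) cD2
    (fun x hx h1 =>
      (abs_of_nonneg (norm_nonneg (fderiv ℝ (fderiv ℝ u) x))).le.trans (hM x hx h1).2.2.1)
    (fun x hx h2 =>
      (abs_of_nonneg (norm_nonneg (fderiv ℝ (fderiv ℝ u) x))).le.trans (far2 x hx h2))
  obtain ⟨K₃, hK₃, hb₃⟩ := exists_global_decay ln (F := fun x : Eu n => pd u ln x / x ln)
    (s := (n : ℝ) + b) (M := M) (A := n * A / b) (by linarith) cp
    (fun x hx h1 => (hM x hx h1).2.2.2)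
    (fun x hx h2 => by
      have hf0 : f x = 0 := by
        by_contra h
        have := mem_ball_zero_iff.1 (hfsupp x h).1
        linarith
      have e : pd u ln x / x ln = -(∑ i, pd2 u i i x) / b := by
        have := heq x hx
        rw [hf0, mul_div_assoc] at this
        rw [eq_div_iff hb.ne']
        linarith
      rw [e, abs_div, abs_neg, abs_of_pos hb]
      calc |∑ i, pd2 u i i x| / b ≤ (∑ i : Fin n, A / ‖x‖ ^ ((n : ℝ) + b)) / b := by
            gcongr
            refine (Finset.abs_sum_le_sum_abs _ _).trans (Finset.sum_le_sum fun i _ => ?_)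
            exact (pd2_le x hx i i).trans (far2 x hx h2)
        _ = _ := by
            simp only [Finset.sum_const, Finset.card_univ, Fintype.card_fin, nsmul_eq_mul]
            ring)
  set K := max (max K₁ K₂) (max K₃ (|Mf| * 2 ^ ((n : ℝ) + b))) with hK
  have hK0 : 0 ≤ K := hK₁.trans ((le_max_left _ _).trans (le_max_left _ _))
  let α : Eu n → ℝ := fun x => (1 + ‖x‖) ^ (-((n : ℝ) - 1 + b))
  let β : Eu n → ℝ := fun x => (1 + ‖x‖) ^ (-((n : ℝ) + b))
  have hα0 : ∀ x, 0 ≤ α x := fun x => by positivity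
  have hβ0 : ∀ x, 0 ≤ β x := fun x => by positivity
  have hβα : ∀ x, β x ≤ α x := fun x =>
    Real.rpow_le_rpow_of_exponent_le (by linarith [norm_nonneg x]) (by linarith)
  have hαβ : ∀ x, α x * β x = (1 + ‖x‖) ^ (-(2 * n - 1 + 2 * b)) := fun x => by
    simp only [α, β]
    rw [← Real.rpow_add (by positivity)]
    congr 1; ring
  have B1 : ∀ x : Eu n, 0 < x ln → ∀ i, |pd u i x| ≤ K * α x := fun x hx i => by
    have h := (le_abs_self _).trans (hb₁ x hx)
    refine ((pd_le x i).trans h).trans (mul_le_mul_of_nonneg_right ?_ (hα0 x))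
    exact (le_max_left _ _).trans (le_max_left _ _)
  have B2 : ∀ x : Eu n, 0 < x ln → ∀ i j, |pd2 u i j x| ≤ K * β x := fun x hx i j => by
    have h := (le_abs_self _).trans (hb₂ x hx)
    refine ((pd2_le x hx i j).trans h).trans (mul_le_mul_of_nonneg_right ?_ (hβ0 x))
    exact (le_max_right _ _).trans (le_max_left _ _)
  have B3 : ∀ x : Eu n, 0 < x ln → |pd u ln x / x ln| ≤ K * β x := fun x hx => by
    refine (hb₃ x hx).trans (mul_le_mul_of_nonneg_right ?_ (hβ0 x))
    exact (le_max_left _ _).trans (le_max_right _ _)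
  have B4 : ∀ x : Eu n, |f x| ≤ K * β x := fun x => by
    by_cases h : f x = 0
    · rw [h, abs_zero]; exact mul_nonneg hK0 (hβ0 x)
    have hx1 : ‖x‖ < 1 := mem_ball_zero_iff.1 (hfsupp x h).1
    have h0 : 0 < 1 + ‖x‖ := by positivity
    have h1 : |Mf| * 2 ^ ((n : ℝ) + b) ≤ K := (le_max_right _ _).trans (le_max_right _ _)
    refine le_trans ?_ (mul_le_mul_of_nonneg_right h1 (hβ0 x))
    simp only [β]
    rw [Real.rpow_neg h0.le, ← div_eq_mul_inv, le_div_iff₀ (by positivity)]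
    exact mul_le_mul ((hMf x).trans (le_abs_self _))
      (Real.rpow_le_rpow h0.le (by linarith) (by linarith)) (by positivity) (abs_nonneg _)
  have prod_le : ∀ {x : Eu n} {p q : ℝ}, |p| ≤ K * α x → |q| ≤ K * β x →
      |p * q| ≤ K ^ 2 * (α x * β x) := by
    intro x p q hp hq
    rw [abs_mul]
    calc |p| * |q| ≤ (K * α x) * (K * β x) :=
          mul_le_mul hp hq (abs_nonneg _) (mul_nonneg hK0 (hα0 x))
      _ = _ := by ring
  have sq_le : ∀ {x : Eu n} {q : ℝ}, |q| ≤ K * β x → |q ^ 2| ≤ K ^ 2 * (α x * β x) := by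
    intro x q hq
    rw [sq]
    exact prod_le (hq.trans (mul_le_mul_of_nonneg_left (hβα x) hK0)) hq
  have S2 : ∀ x : Eu n, 0 < x ln →
      |∑ i, ∑ j, pd2 u i j x ^ 2| ≤ (n ^ 2 * K ^ 2) * (α x * β x) := by
    intro x hx
    calc |∑ i, ∑ j, pd2 u i j x ^ 2| ≤ ∑ i : Fin n, ∑ j : Fin n, K ^ 2 * (α x * β x) :=
          (Finset.abs_sum_le_sum_abs _ _).trans (Finset.sum_le_sum fun i _ =>
            (Finset.abs_sum_le_sum_abs _ _).trans (Finset.sum_le_sum fun j _ =>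
              sq_le (B2 x hx i j)))
      _ = _ := by
          simp only [Finset.sum_const, Finset.card_univ, Fintype.card_fin, nsmul_eq_mul]
          ring
  have V2 : ∀ x : Eu n, 0 < x ln → ∀ i,
      |f x * pd u i x + ∑ j, pd u j x * pd2 u i j x| ≤ ((n + 1) * K ^ 2) * (α x * β x) := by
    intro x hx i
    calc |f x * pd u i x + ∑ j, pd u j x * pd2 u i j x|
        ≤ |f x * pd u i x| + |∑ j, pd u j x * pd2 u i j x| := abs_add_le _ _
      _ ≤ K ^ 2 * (α x * β x) + ∑ j : Fin n, K ^ 2 * (α x * β x) := by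
          refine add_le_add ?_ ((Finset.abs_sum_le_sum_abs _ _).trans
            (Finset.sum_le_sum fun j _ => prod_le (B1 x hx j) (B2 x hx i j)))
          rw [mul_comm]
          exact prod_le (B1 x hx i) (B4 x)
      _ = _ := by
          simp only [Finset.sum_const, Finset.card_univ, Fintype.card_fin, nsmul_eq_mul]
          ring
  have hHm : MeasurableSet {x : Eu n | 0 < x ln} := hopen.measurableSet
  have m1 : ∀ i, AEMeasurable (pd u i) (volume.restrict {x : Eu n | 0 < x ln}) := fun i =>
    (c1 i).aemeasurable hHm
  have m2 : ∀ i j, AEMeasurable (pd2 u i j) (volume.restrict {x : Eu n | 0 < x ln}) :=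
    fun i j => (c2 i j).aemeasurable hHm
  have mp : AEMeasurable (fun x : Eu n => pd u ln x / x ln)
      (volume.restrict {x : Eu n | 0 < x ln}) := cp.aemeasurable hHm
  have mf : AEMeasurable f (volume.restrict {x : Eu n | 0 < x ln}) := hfmeas.aemeasurable
  have mw : AEMeasurable (fun x : Eu n => x ln ^ b) (volume.restrict {x : Eu n | 0 < x ln}) := by
    have := measurable_coord ln
    fun_prop
  have mS : AEMeasurable (fun x => ∑ i, ∑ j, pd2 u i j x ^ 2)
      (volume.restrict {x : Eu n | 0 < x ln}) :=
    Finset.aemeasurable_fun_sum _ fun i _ => Finset.aemeasurable_fun_sum _ fun j _ =>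
      (m2 i j).pow_const 2
  have mV : ∀ i, AEMeasurable (fun x => f x * pd u i x + ∑ j, pd u j x * pd2 u i j x)
      (volume.restrict {x : Eu n | 0 < x ln}) := fun i =>
    (mf.mul (m1 i)).add (Finset.aemeasurable_fun_sum _ fun j _ => (m1 j).mul (m2 i j))
  have W1 := integrableOn_rpow_mul_one_add_norm hn ln hb
  have W2 := integrableOn_rpow_div_mul_one_add_norm hn ln hb
  simp only [← hαβ] at W1 W2
  have int_of : ∀ {F : Eu n → ℝ} {C : ℝ},
      AEMeasurable F (volume.restrict {x : Eu n | 0 < x ln}) →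
      (∀ x : Eu n, 0 < x ln → |F x| ≤ C * (α x * β x)) →
      IntegrableOn (fun x => F x * x ln ^ b) {x : Eu n | 0 < x ln} := by
    intro F C hFm hF
    refine Integrable.mono' (W1.const_mul C) (hFm.mul mw).aestronglyMeasurable ?_
    refine (ae_restrict_iff' hHm).2 (Eventually.of_forall fun x (hx : 0 < x ln) => ?_)
    have hw : 0 ≤ x ln ^ b := by positivity
    rw [norm_mul, Real.norm_eq_abs, Real.norm_of_nonneg hw]
    calc |F x| * x ln ^ b ≤ (C * (α x * β x)) * x ln ^ b :=
          mul_le_mul_of_nonneg_right (hF x hx) hw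
      _ = _ := by ring
  have I1 := int_of mS S2
  have I2 := int_of (mp.pow_const 2) fun x hx => sq_le (B3 x hx)
  have I3 := int_of (mf.pow_const 2) fun x hx => sq_le (B4 x)
  obtain ⟨φ, C, hC0, φ1, φc, φH, φle, φlim, φpd⟩ := exists_halfSpace_cutoff ln
  let Q : Eu n → ℝ := fun x =>
    x ln ^ b * (f x ^ 2 - ∑ i, ∑ j, pd2 u i j x ^ 2 - b * (pd u ln x / x ln) ^ 2)
  let V : Fin n → Eu n → ℝ := fun i x => f x * pd u i x + ∑ j, pd u j x * pd2 u i j x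
  let F : ℕ → Eu n → ℝ := fun m x => φ m x * Q x - x ln ^ b * ∑ i, pd (φ m) i x * V i x
  have F0 : ∀ m, ∫ x in {x : Eu n | 0 < x ln}, F m x = 0 := by
    intro m
    rw [setIntegral_eq_integral_of_forall_compl_eq_zero]
    · exact integral_cutoff_energy ln b hu (φ1 m) (φc m) (φH m) heq
    · intro x hx
      have hx' : x ∉ tsupport (φ m) := fun h => hx (φH m h)
      simp [F, pd_eq_zero_of_notMem hx', image_eq_zero_of_notMem_tsupport hx']
  have mQ : AEMeasurable Q (volume.restrict {x : Eu n | 0 < x ln}) :=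
    mw.mul (((mf.pow_const 2).sub mS).sub ((mp.pow_const 2).const_mul b))
  have lim : Tendsto (fun m => ∫ x in {x : Eu n | 0 < x ln}, F m x) atTop
      (𝓝 (∫ x in {x : Eu n | 0 < x ln}, Q x)) := by
    refine tendsto_integral_of_dominated_convergence
      (fun x => (1 + n ^ 2 + b) * K ^ 2 * (x ln ^ b * (α x * β x)) +
        n * C * ((n + 1) * K ^ 2) * (x ln ^ b * (α x * β x) +
          (if x ln < 1 then (x ln)⁻¹ else 0) * (x ln ^ b * (α x * β x)))) ?_ ?_ ?_ ?_
    · intro m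
      refine AEMeasurable.aestronglyMeasurable (AEMeasurable.sub
        ((φ1 m).continuous.measurable.aemeasurable.mul mQ) (mw.mul ?_))
      refine Finset.aemeasurable_fun_sum _ fun i _ => AEMeasurable.mul ?_ (mV i)
      exact (Continuous.measurable (continuous_iff_continuousAt.2 fun x =>
        continuousAt_pd (φ1 m).contDiffAt i)).aemeasurable
    · exact (W1.const_mul _).add ((W1.add W2).const_mul _)
    · intro m
      refine (ae_restrict_iff' hHm).2 (Eventually.of_forall fun x (hx : 0 < x ln) => ?_)
      have hw : 0 ≤ x ln ^ b := by positivity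
      set r := if x ln < 1 then (x ln)⁻¹ else 0 with hr
      have hr0 : 0 ≤ r := by rw [hr]; split_ifs <;> positivity
      set γ := α x * β x with hγ
      have hγ0 : 0 ≤ γ := mul_nonneg (hα0 x) (hβ0 x)
      have hQ : |Q x| ≤ (1 + n ^ 2 + b) * K ^ 2 * (x ln ^ b * γ) := by
        have a1 := abs_le.1 (sq_le (B4 x))
        have a2 := abs_le.1 (S2 x hx)
        have a3 := abs_le.1 (sq_le (B3 x hx))
        have : |f x ^ 2 - ∑ i, ∑ j, pd2 u i j x ^ 2 - b * (pd u ln x / x ln) ^ 2|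
            ≤ (1 + n ^ 2 + b) * K ^ 2 * γ := by
          have a4 := mul_le_mul_of_nonneg_left a3.1 hb.le
          have a5 := mul_le_mul_of_nonneg_left a3.2 hb.le
          rw [abs_le]
          constructor <;> linarith [a1.1, a1.2, a2.1, a2.2]
        simp only [Q]
        rw [abs_mul, abs_of_nonneg hw]
        calc _ ≤ x ln ^ b * ((1 + n ^ 2 + b) * K ^ 2 * γ) := by gcongr
          _ = _ := by ring
      have hS : |∑ i, pd (φ m) i x * V i x| ≤ n * (C * (1 + r) * (((n + 1) * K ^ 2) * γ)) := by
        calc |∑ i, pd (φ m) i x * V i x|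
            ≤ ∑ i : Fin n, C * (1 + r) * (((n + 1) * K ^ 2) * γ) := by
              refine (Finset.abs_sum_le_sum_abs _ _).trans (Finset.sum_le_sum fun i _ => ?_)
              rw [abs_mul]
              exact mul_le_mul (φpd m x i hx) (V2 x hx i) (abs_nonneg _) (by positivity)
          _ = _ := by simp
      have hφQ : |φ m x * Q x| ≤ |Q x| := by
        rw [abs_mul]
        exact mul_le_of_le_one_left (abs_nonneg _) (φle m x)
      calc ‖F m x‖ ≤ |φ m x * Q x| + |x ln ^ b * ∑ i, pd (φ m) i x * V i x| := abs_sub _ _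
        _ ≤ (1 + n ^ 2 + b) * K ^ 2 * (x ln ^ b * γ) +
            x ln ^ b * (n * (C * (1 + r) * (((n + 1) * K ^ 2) * γ))) := by
            refine add_le_add (hφQ.trans hQ) ?_
            rw [abs_mul, abs_of_nonneg hw]
            gcongr
        _ = _ := by ring
    · refine (ae_restrict_iff' hHm).2 (Eventually.of_forall fun x (hx : 0 < x ln) => ?_)
      refine tendsto_const_nhds.congr' ?_
      filter_upwards [φlim x hx] with m hm
      simp [F, hm.1, hm.2]
  simp only [F0] at lim
  have Q0 : ∫ x in {x : Eu n | 0 < x ln}, Q x = 0 := tendsto_nhds_unique lim tendsto_const_nhds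
  have Qe : ∀ x, Q x = f x ^ 2 * x ln ^ b - (∑ i, ∑ j, pd2 u i j x ^ 2) * x ln ^ b
      - b * ((pd u ln x / x ln) ^ 2 * x ln ^ b) := fun x => by
    simp only [Q]; ring
  simp only [Qe] at Q0
  have I31 : Integrable (fun x : Eu n =>
      f x ^ 2 * x ln ^ b - (∑ i, ∑ j, pd2 u i j x ^ 2) * x ln ^ b)
      (volume.restrict {x : Eu n | 0 < x ln}) := I3.sub I1
  rw [integral_sub I31 (I2.const_mul b), integral_sub I3 I1, integral_const_mul] at Q0
  linarith
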